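/- Let h be a Hessenberg function on {1,…,n} and s = diag(1, 0, …, 0). Then the ideal I_{s,h} ⊆ R is a radical ideal. -/

import Mathlib

open MvPolynomial

noncomputable section

/-- The polynomial ring `R = ℂ[z_{ij} : 1 ≤ i,j ≤ n]` (indices 0-based). -/
abbrev R (n : ℕ) : Type := MvPolynomial (Fin n × Fin n) ℂ

/-- The ideal `L_i = ⟨z_{11}, …, z_{1i}⟩` (first row, first `i` variables; 0-based columns `j < i`).
    `Lideal n 0 = ⟨0⟩`. -/
def Lideal (n : ℕ) [NeZero n] (i : ℕ) : Ideal (R n) :=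
  Ideal.span { p | ∃ j : Fin n, (j : ℕ) < i ∧ p = X ((0 : Fin n), j) }

/-- The ideal `K_j`, generated by the `j × j` minors `p_B = det((z_{kℓ})_{k ∈ B, 1 ≤ ℓ ≤ j})`
    over all `j`-element subsets `B ⊆ {2, …, n}` (0-based: rows `B k ≠ 0`, columns `0,…,j-1`).
    For `j = n` (or `j > n`) there are no such subsets and the ideal is `⟨0⟩`. -/
def Kideal (n : ℕ) (j : ℕ) : Ideal (R n) :=
  Ideal.span { p | ∃ (hj : j ≤ n) (B : Fin j → Fin n), StrictMono B ∧ (∀ k, (B k : ℕ) ≠ 0) ∧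
    p = (Matrix.of fun k l : Fin j => (X (B k, Fin.castLE hj l) : R n)).det }

/-- A Hessenberg function (0-based): `h` is monotone with `h i ≥ i` for all `i`. -/
def IsHessenberg (n : ℕ) (h : Fin n → Fin n) : Prop := Monotone h ∧ ∀ i, i ≤ h i

/-- `i` is a corner of `h`, i.e. (1-based) `h(i) > h(i-1)` with the convention `h(0) = 0`;
    0-based, `i = 0` is always a corner. -/
def HessCorner (n : ℕ) (h : Fin n → Fin n) (i : Fin n) : Prop :=
  (i : ℕ) = 0 ∨ h ⟨(i : ℕ) - 1, lt_of_le_of_lt (Nat.sub_le _ _) i.isLt⟩ < h i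

/-- The `n × (i + h(i))` matrix with columns `x·v_1, …, x·v_i, v_1, …, v_{h(i)}`,
    where `v_j` is the `j`-th column of the generic matrix `Z`. Here (0-based) the paper's
    `i` is `a+1` and the paper's `h(i)` is `(h a) + 1`. -/
def hessMat (n : ℕ) (x : Matrix (Fin n) (Fin n) ℂ) (h : Fin n → Fin n) (a : Fin n) :
    Matrix (Fin n) (Fin ((a : ℕ) + 1) ⊕ Fin (((h a) : ℕ) + 1)) (R n) :=
  Matrix.of fun r c => Sum.elim
    (fun c' => ∑ k : Fin n, MvPolynomial.C (x r k) * X (k, Fin.castLE a.isLt c'))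
    (fun c' => X (r, Fin.castLE (h a).isLt c')) c

/-- The ideal `I_{x,h,i}` generated by all `(h(i)+1) × (h(i)+1)` minors of `hessMat`
    (paper's `h(i)+1` is `(h a) + 2` 0-based). -/
def hessIdealAt (n : ℕ) (x : Matrix (Fin n) (Fin n) ℂ) (h : Fin n → Fin n) (a : Fin n) :
    Ideal (R n) :=
  Ideal.span { p | ∃ (f : Fin (((h a) : ℕ) + 2) → Fin n)
    (g : Fin (((h a) : ℕ) + 2) → Fin ((a : ℕ) + 1) ⊕ Fin (((h a) : ℕ) + 1)),
    p = ((hessMat n x h a).submatrix f g).det }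

/-- The ideal `I_{x,h} = Σ_{i=1}^n I_{x,h,i}`. -/
def hessIdeal (n : ℕ) (x : Matrix (Fin n) (Fin n) ℂ) (h : Fin n → Fin n) : Ideal (R n) :=
  ∑ a : Fin n, hessIdealAt n x h a

/-- The minimal semisimple element `s = diag(1, 0, …, 0)`. -/
def sMat (n : ℕ) [NeZero n] : Matrix (Fin n) (Fin n) ℂ :=
  Matrix.diagonal (fun i => if i = 0 then 1 else 0)

/-- The rank `r_{pq}(w)` of the top-left `(p+1) × (q+1)` (0-based) submatrix of the
    permutation matrix of `w`. -/
def rankpq (n : ℕ) (w : Equiv.Perm (Fin n)) (p q : Fin n) : ℕ :=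
  (Finset.univ.filter fun j : Fin n => j ≤ q ∧ w j ≤ p).card

/-- The Schubert determinantal ideal `I_w`: generated, over all `p, q`, by the minors of size
    `1 + r_{pq}(w)` of the top-left `(p+1) × (q+1)` (0-based) submatrix of the generic matrix. -/
def schubertIdeal (n : ℕ) (w : Equiv.Perm (Fin n)) : Ideal (R n) :=
  Ideal.span { m | ∃ (p q : Fin n) (f g : Fin (rankpq n w p q + 1) → Fin n),
    (∀ k, f k ≤ p) ∧ (∀ k, g k ≤ q) ∧
    m = (Matrix.of fun k l => (X (f k, g l) : R n)).det }

/-- The generic matrix `Z`. -/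
def genZ (n : ℕ) : Matrix (Fin n) (Fin n) (R n) :=
  Matrix.of fun k l => X (k, l)

/-- The ideal generated by the maximal minors of the submatrix of the generic matrix with rows
in `s` and columns `c`. -/
def maxMinorIdeal {ι κ : Type*} {q : ℕ} (s : Set ι) (c : Fin q → κ) :
    Ideal (MvPolynomial (ι × κ) ℂ) :=
  Ideal.span { p | ∃ B : Fin q → ι, (∀ k, B k ∈ s) ∧
    p = (Matrix.of fun k l : Fin q => (X (B k, c l) : MvPolynomial (ι × κ) ℂ)).det }

/-- The columns `c` of the matrix `x`, restricted to the rows in `s`, are linearly dependent. -/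
def ColsDependent {ι κ : Type*} {q : ℕ} (s : Set ι) (c : Fin q → κ) (x : ι × κ → ℂ) : Prop :=
  ∃ w : Fin q → ℂ, w ≠ 0 ∧ ∀ i ∈ s, ∑ l, w l * x (i, c l) = 0

/-- `f` vanishes at all matrices whose columns `c`, restricted to `s`, are dependent. -/
def VanishesOnDependent {ι κ : Type*} {q : ℕ} (s : Set ι) (c : Fin q → κ)
    (f : MvPolynomial (ι × κ) ℂ) : Prop :=
  ∀ x : ι × κ → ℂ, ColsDependent s c x → eval x f = 0

section SetZero

variable {τ : Type*} [DecidableEq τ]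

/-- Substitute `0` for the variable `t`. -/
def setZero (t : τ) : MvPolynomial τ ℂ →ₐ[ℂ] MvPolynomial τ ℂ :=
  aeval (Function.update X t 0)

theorem eval_setZero (t : τ) (x : τ → ℂ) (f : MvPolynomial τ ℂ) :
    eval x (setZero t f) = eval (Function.update x t 0) f := by
  induction f using MvPolynomial.induction_on with
  | C a => simp [setZero]
  | add p q hp hq => simp [hp, hq]
  | mul_X p i hp =>
    by_cases h : i = t
    · subst h; simp [setZero]
    · simp [hp]; simp [setZero, h]

theorem setZero_idem (t : τ) (f : MvPolynomial τ ℂ) :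
    setZero t (setZero t f) = setZero t f := by
  apply MvPolynomial.funext
  intro x
  simp [eval_setZero]

theorem eval_update_of_setZero_eq {t : τ} {f : MvPolynomial τ ℂ} (hf : setZero t f = f)
    (x : τ → ℂ) (a : ℂ) : eval (Function.update x t a) f = eval x f := by
  rw [← hf, eval_setZero, eval_setZero]; simp

theorem exists_eq_setZero_add (t : τ) (f : MvPolynomial τ ℂ) :
    ∃ g, f = setZero t f + X t * g := by
  induction f using MvPolynomial.induction_on with
  | C a => exact ⟨0, by simp [setZero]⟩
  | add p q hp hq =>
    obtain ⟨a, ha⟩ := hp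
    obtain ⟨b, hb⟩ := hq
    refine ⟨a + b, ?_⟩
    rw [map_add]
    linear_combination ha + hb
  | mul_X p i hp =>
    obtain ⟨a, ha⟩ := hp
    by_cases h : i = t
    · subst h; exact ⟨p, by simp [setZero, mul_comm]⟩
    · have hX : setZero t (X i : MvPolynomial τ ℂ) = X i := by simp [setZero, h]
      refine ⟨a * X i, ?_⟩
      rw [map_mul, hX]
      linear_combination X i * ha

/-- Every polynomial is a univariate polynomial in `X t` with coefficients free of `t`. -/
theorem exists_polynomial_in_variable (t : τ) (f : MvPolynomial τ ℂ) :
    ∃ F : Polynomial (MvPolynomial τ ℂ), (∀ k, setZero t (F.coeff k) = F.coeff k) ∧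
      F.eval (X t) = f := by
  induction f using MvPolynomial.induction_on with
  | C a =>
    refine ⟨Polynomial.C (C a), fun k => ?_, by simp⟩
    rw [Polynomial.coeff_C]; split_ifs <;> simp [setZero]
  | add p q hp hq =>
    obtain ⟨F, hF, rfl⟩ := hp
    obtain ⟨G, hG, rfl⟩ := hq
    exact ⟨F + G, fun k => by simp [hF, hG], by simp⟩
  | mul_X p i hp =>
    obtain ⟨F, hF, rfl⟩ := hp
    by_cases h : i = t
    · subst h
      refine ⟨F * Polynomial.X, fun k => ?_, by simp⟩
      cases k <;> simp [hF]
    · refine ⟨F * Polynomial.C (X i), fun k => ?_, by simp⟩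
      have hX : setZero t (X i : MvPolynomial τ ℂ) = X i := by simp [setZero, h]
      simp [hF, hX]

end SetZero

theorem ColsDependent.eval_det_eq_zero {ι κ : Type*} {q : ℕ} {s : Set ι} {c : Fin q → κ}
    {x : ι × κ → ℂ} (h : ColsDependent s c x) {B : Fin q → ι} (hB : ∀ k, B k ∈ s) :
    eval x (Matrix.of fun k l : Fin q => (X (B k, c l) : MvPolynomial (ι × κ) ℂ)).det = 0 := by
  obtain ⟨w, hw, hx⟩ := h
  rw [RingHom.map_det]
  apply Matrix.exists_mulVec_eq_zero_iff.mp
  refine ⟨w, hw, ?_⟩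
  ext k
  simpa [Matrix.mulVec, dotProduct, mul_comm] using hx (B k) (hB k)

theorem vanishesOnDependent_of_mem_maxMinorIdeal {ι κ : Type*} {q : ℕ} {s : Set ι}
    {c : Fin q → κ} {f : MvPolynomial (ι × κ) ℂ} (hf : f ∈ maxMinorIdeal s c) :
    VanishesOnDependent s c f := by
  intro x hx
  have : maxMinorIdeal s c ≤ RingHom.ker (eval x) := by
    refine Ideal.span_le.mpr ?_
    rintro _ ⟨B, hB, rfl⟩
    exact hx.eval_det_eq_zero hB
  exact this hf

theorem maxMinorIdeal_mono {ι κ : Type*} {q : ℕ} {s t : Set ι} (hst : s ⊆ t) (c : Fin q → κ) :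
    maxMinorIdeal s c ≤ maxMinorIdeal t c := by
  apply Ideal.span_mono
  rintro _ ⟨B, hB, rfl⟩
  exact ⟨B, fun k => hst (hB k), rfl⟩

section Step

variable {ι κ : Type*} [DecidableEq ι] [DecidableEq κ] {q : ℕ} {s : Set ι} {ρ : ι}
  {c : Fin (q + 1) → κ}

/-- Degenerating the corner entry to infinity. -/
theorem vanishesOnDependent_coeff (hρ : ρ ∉ s) (hc : Function.Injective c)
    {F : Polynomial (MvPolynomial (ι × κ) ℂ)}
    (hF : ∀ k, setZero (ρ, c (Fin.last q)) (F.coeff k) = F.coeff k) {D : ℕ}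
    (hD : F.natDegree ≤ D)
    (hv : VanishesOnDependent (insert ρ s) c (F.eval (X (ρ, c (Fin.last q))))) :
    VanishesOnDependent s (c ∘ Fin.castSucc) (F.coeff D) := by
  classical
  rintro x ⟨w, hw, hx⟩
  obtain ⟨l₀, hl₀⟩ := Function.ne_iff.mp hw
  set y := (ρ, c (Fin.last q)) with hy
  set u : Fin q → ℂ := Pi.single l₀ (w l₀)⁻¹ with hu
  have huw : ∑ l, w l * u l = 1 := by
    simp only [hu, Pi.single_apply]
    simpa using mul_inv_cancel₀ hl₀
  set α : ℂ := ∑ l : Fin q, w l * x (ρ, c l.castSucc) with hα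
  set d : ι × κ → ℂ := fun p =>
    if p.1 ∈ s then ∑ l : Fin q, if c l.castSucc = p.2 then u l * x (p.1, c (Fin.last q)) else 0
    else 0 with hd
  have hd1 : ∀ i ∈ s, ∀ l : Fin q, d (i, c l.castSucc) = u l * x (i, c (Fin.last q)) := by
    intro i hi l
    simp [hd, hi, hc.eq_iff]
  have hd2 : ∀ i, d (i, c (Fin.last q)) = 0 := by
    intro i
    simp [hd, hc.eq_iff]
  have hd3 : ∀ k, d (ρ, k) = 0 := fun k => by simp [hd, hρ]
  set g : ℂ → ℂ := fun z => ∑ k ∈ Finset.range (D + 1),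
    eval (fun p => x p + z * (α * d p)) (F.coeff k) * z ^ (D - k) with hg
  have hcont : Continuous g := by
    refine continuous_finsetSum _ fun k _ => Continuous.mul ?_ (by fun_prop)
    exact (MvPolynomial.continuous_eval (F.coeff k)).comp (by fun_prop)
  have hne : ∀ z : ℂ, z ≠ 0 → g z = 0 := by
    intro z hz
    set P : ι × κ → ℂ := Function.update (fun p => x p + z * (α * d p)) y z⁻¹ with hP
    have hdep : ColsDependent (insert ρ s) c P := by
      refine ⟨Fin.snoc w (-(α * z)), ?_, ?_⟩
      · intro h0
        apply hw
        funext l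
        simpa using congrFun h0 l.castSucc
      · intro i hi
        rw [Fin.sum_univ_castSucc]
        simp only [Fin.snoc_castSucc, Fin.snoc_last]
        rcases hi with rfl | hi
        · have h1 : P (i, c (Fin.last q)) = z⁻¹ := by simp [hP, hy]
          have h2 : ∀ l : Fin q, P (i, c l.castSucc) = x (i, c l.castSucc) := by
            intro l
            rw [hP, Function.update_of_ne]
            · simp [hd3]
            · simp [hy, hc.eq_iff]
          simp only [h1, h2, ← hα]
          field_simp
          ring
        · have hne : i ≠ ρ := fun h => hρ (h ▸ hi)
          have h1 : ∀ k, P (i, k) = x (i, k) + z * (α * d (i, k)) := by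
            intro k
            rw [hP, Function.update_of_ne]
            simp [hy, hne]
          simp only [h1, hd1 i hi, hd2]
          have h3 := hx i hi
          simp only [Function.comp] at h3
          have h4 : ∑ l : Fin q, w l * (x (i, c l.castSucc) +
              z * (α * (u l * x (i, c (Fin.last q))))) =
              ∑ l : Fin q, w l * x (i, c l.castSucc) +
              (∑ l, w l * u l) * (z * α * x (i, c (Fin.last q))) := by
            rw [Finset.sum_mul, ← Finset.sum_add_distrib]
            exact Finset.sum_congr rfl fun l _ => by ring
          rw [h4, h3, huw]
          ring
    have h0 := hv P hdep
    rw [Polynomial.eval_eq_sum_range' (Nat.lt_succ_of_le hD), map_sum] at h0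
    have h5 : g z = z ^ D * ∑ k ∈ Finset.range (D + 1),
        eval P (F.coeff k * X y ^ k) := by
      rw [Finset.mul_sum]
      refine Finset.sum_congr rfl fun k hk => ?_
      have hk' : k ≤ D := Nat.lt_succ_iff.mp (Finset.mem_range.mp hk)
      rw [map_mul, map_pow, eval_X, hP, eval_update_of_setZero_eq (hF k), Function.update_self]
      obtain ⟨e, rfl⟩ := Nat.exists_eq_add_of_le hk'
      rw [Nat.add_sub_cancel_left, pow_add, inv_pow]
      field_simp
    rw [h5]
    exact mul_eq_zero_of_right _ h0
  have hzero : g = fun _ => 0 :=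
    hcont.ext_on (dense_compl_singleton (0 : ℂ)) continuous_const fun z hz => hne z hz
  have := congrFun hzero 0
  rw [hg] at this
  simp only [zero_mul, add_zero] at this
  rw [Finset.sum_eq_single D] at this
  · simpa using this
  · intro k hk hkD
    have : k < D + 1 := Finset.mem_range.mp hk
    rw [zero_pow (by omega), mul_zero]
  · simp

theorem vanishesOnDependent_of_setZero_eq (hρ : ρ ∉ s) (hc : Function.Injective c)
    {f : MvPolynomial (ι × κ) ℂ} (hf : setZero (ρ, c (Fin.last q)) f = f)
    (hv : VanishesOnDependent (insert ρ s) c f) : VanishesOnDependent s c f := by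
  rintro x ⟨v, hv0, hx⟩
  by_cases hl : v (Fin.last q) = 0
  · have := vanishesOnDependent_coeff (F := Polynomial.C f) (D := 0) hρ hc
      (fun k => by rw [Polynomial.coeff_C]; split_ifs <;> simp [hf]) (by simp) (by simpa using hv)
    rw [Polynomial.coeff_C_zero] at this
    refine this x ⟨v ∘ Fin.castSucc, ?_, ?_⟩
    · intro h0
      apply hv0
      funext l
      refine Fin.lastCases hl (fun l => ?_) l
      exact congrFun h0 l
    · intro i hi
      have := hx i hi
      rw [Fin.sum_univ_castSucc, hl] at this
      simpa using this
  · rw [← eval_update_of_setZero_eq hf x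
      (-(∑ l : Fin q, v l.castSucc * x (ρ, c l.castSucc)) / v (Fin.last q))]
    refine hv _ ⟨v, hv0, ?_⟩
    rintro i (rfl | hi)
    · rw [Fin.sum_univ_castSucc, Function.update_self]
      have : ∀ l : Fin q, (i, c l.castSucc) ≠ (i, c (Fin.last q)) := by
        intro l; simp [hc.eq_iff]
      simp only [Function.update_of_ne (this _)]
      field_simp
      ring
    · have hne : i ≠ ρ := fun h => hρ (h ▸ hi)
      have : ∀ k, (i, k) ≠ (ρ, c (Fin.last q)) := by simp [hne]
      simp only [Function.update_of_ne (this _)]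
      exact hx i hi

/-- Laplace expansion of a maximal minor with respect to the corner entry. -/
theorem det_eq_corner_mul_add (hρ : ρ ∉ s) (hc : Function.Injective c) {B : Fin q → ι}
    (hB : ∀ k, B k ∈ s) :
    ∃ r : MvPolynomial (ι × κ) ℂ, setZero (ρ, c (Fin.last q)) r = r ∧
      (Matrix.of fun k l : Fin (q + 1) =>
        (X ((Fin.snoc B ρ : Fin (q + 1) → ι) k, c l) : MvPolynomial (ι × κ) ℂ)).det =
      (Matrix.of fun k l : Fin q =>
        (X (B k, c l.castSucc) : MvPolynomial (ι × κ) ℂ)).det * X (ρ, c (Fin.last q)) + r := by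
  have hB' : ∀ k, B k ≠ ρ := fun k h => hρ (h ▸ hB k)
  refine ⟨∑ l : Fin q, (-1) ^ (q + (l : ℕ)) * X (ρ, c l.castSucc) *
    (Matrix.of fun (k : Fin q) (m : Fin q) =>
      (X (B k, c (l.castSucc.succAbove m)) : MvPolynomial (ι × κ) ℂ)).det, ?_, ?_⟩
  · rw [map_sum]
    refine Finset.sum_congr rfl fun l _ => ?_
    rw [map_mul, map_mul, AlgHom.map_det]
    congr 1
    · simp [setZero, hc.eq_iff]
    · congr 1
      ext1 k m
      simp [setZero, hB']
  · rw [Matrix.det_succ_row _ (Fin.last q), Fin.sum_univ_castSucc]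
    refine (add_comm _ _).trans (congrArg₂ (· + ·) ?_ ?_)
    · rw [Fin.val_last, (Even.add_self q).neg_one_pow, one_mul]
      refine (mul_comm _ _).trans ?_
      simp [Matrix.submatrix, Fin.succAbove_last]
    · refine Finset.sum_congr rfl fun l _ => ?_
      simp [Matrix.submatrix, Fin.succAbove_last]

theorem exists_mul_corner_add_mem (hρ : ρ ∉ s) (hc : Function.Injective c)
    {a : MvPolynomial (ι × κ) ℂ} (ha : a ∈ maxMinorIdeal s (c ∘ Fin.castSucc)) :
    ∃ r, setZero (ρ, c (Fin.last q)) r = r ∧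
      setZero (ρ, c (Fin.last q)) a * X (ρ, c (Fin.last q)) + r ∈
        maxMinorIdeal (insert ρ s) c := by
  induction ha using Submodule.span_induction with
  | mem p hp =>
    obtain ⟨B, hB, rfl⟩ := hp
    obtain ⟨r, hr, h⟩ := det_eq_corner_mul_add hρ hc hB
    refine ⟨r, hr, ?_⟩
    have hB' : ∀ k, B k ≠ ρ := fun k h => hρ (h ▸ hB k)
    have hdet : setZero (ρ, c (Fin.last q)) (Matrix.of fun k l : Fin q =>
        (X (B k, (c ∘ Fin.castSucc) l) : MvPolynomial (ι × κ) ℂ)).det =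
        (Matrix.of fun k l : Fin q => (X (B k, c l.castSucc) : MvPolynomial (ι × κ) ℂ)).det := by
      rw [AlgHom.map_det]
      congr 1
      ext1 k m
      simp [setZero, hB']
    rw [hdet, ← h]
    refine Ideal.subset_span ⟨Fin.snoc B ρ, fun k => ?_, rfl⟩
    refine Fin.lastCases ?_ (fun k => ?_) k
    · simp
    · simpa using Or.inr (hB k)
  | zero => exact ⟨0, by simp, by simp⟩
  | add p p' _ _ hp hp' =>
    obtain ⟨r, hr, h⟩ := hp
    obtain ⟨r', hr', h'⟩ := hp'
    refine ⟨r + r', by simp [hr, hr'], ?_⟩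
    convert Ideal.add_mem _ h h' using 1
    rw [map_add]
    ring
  | smul b p _ hp =>
    obtain ⟨r, hr, h⟩ := hp
    refine ⟨setZero (ρ, c (Fin.last q)) b * r, by simp [hr, setZero_idem], ?_⟩
    convert Ideal.mul_mem_left _ (setZero (ρ, c (Fin.last q)) b) h using 1
    rw [smul_eq_mul, map_mul]
    ring

theorem mem_maxMinorIdeal_insert (hρ : ρ ∉ s) (hc : Function.Injective c)
    (ih : ∀ f, VanishesOnDependent s c f → f ∈ maxMinorIdeal s c)
    (ih' : ∀ f, VanishesOnDependent s (c ∘ Fin.castSucc) f →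
      f ∈ maxMinorIdeal s (c ∘ Fin.castSucc))
    {f : MvPolynomial (ι × κ) ℂ} (hf : VanishesOnDependent (insert ρ s) c f) :
    f ∈ maxMinorIdeal (insert ρ s) c := by
  obtain ⟨F, hF, rfl⟩ := exists_polynomial_in_variable (ρ, c (Fin.last q)) f
  obtain ⟨D, hD⟩ : ∃ D, F.natDegree ≤ D := ⟨_, le_rfl⟩
  induction D generalizing F with
  | zero =>
    rw [Polynomial.eq_C_of_natDegree_le_zero hD, Polynomial.eval_C] at hf ⊢
    exact maxMinorIdeal_mono (Set.subset_insert _ _) c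
      (ih _ (vanishesOnDependent_of_setZero_eq hρ hc (hF 0) hf))
  | succ D ihD =>
    obtain ⟨r, hr, hmem⟩ := exists_mul_corner_add_mem hρ hc
      (ih' _ (vanishesOnDependent_coeff hρ hc hF hD hf))
    rw [hF] at hmem
    set y := (ρ, c (Fin.last q))
    set a := F.coeff (D + 1) with ha
    have hmem' := Ideal.mul_mem_right (X y ^ D) _ hmem
    set G : Polynomial (MvPolynomial (ι × κ) ℂ) :=
      F - Polynomial.monomial (D + 1) a - Polynomial.monomial D r with hG
    have hGF : F.eval (X y) = G.eval (X y) + (a * X y + r) * X y ^ D := by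
      simp only [hG, Polynomial.eval_sub, Polynomial.eval_monomial]
      ring
    rw [hGF]
    refine Ideal.add_mem _ (ihD G (fun k => ?_) (fun x hx => ?_) ?_) hmem'
    · simp only [hG, Polynomial.coeff_sub, Polynomial.coeff_monomial, map_sub, hF]
      split_ifs <;> simp [hr, ha, hF]
    · have h1 := hf x hx
      have h2 := vanishesOnDependent_of_mem_maxMinorIdeal hmem' x hx
      rw [hGF, map_add, h2, add_zero] at h1
      exact h1
    · rw [Polynomial.natDegree_le_iff_coeff_eq_zero]
      intro N hN
      simp only [hG, Polynomial.coeff_sub, Polynomial.coeff_monomial]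
      rw [if_neg hN.ne]
      split_ifs with h
      · subst h; simp [ha]
      · rw [Polynomial.coeff_eq_zero_of_natDegree_lt (by omega)]; simp

end Step

/-- A polynomial vanishing at all matrices of non-maximal rank lies in the ideal of maximal
minors. -/
theorem mem_maxMinorIdeal_of_vanishesOnDependent {ι κ : Type*} (s : Finset ι) {q : ℕ}
    {c : Fin q → κ} (hc : Function.Injective c) {f : MvPolynomial (ι × κ) ℂ}
    (hf : VanishesOnDependent (s : Set ι) c f) : f ∈ maxMinorIdeal (s : Set ι) c := by
  classical
  induction s using Finset.induction_on generalizing q f with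
  | empty =>
    cases q with
    | zero =>
      have : (1 : MvPolynomial (ι × κ) ℂ) ∈ maxMinorIdeal ((∅ : Finset ι) : Set ι) c :=
        Ideal.subset_span ⟨Fin.elim0, fun k => k.elim0, by simp⟩
      exact (Ideal.eq_top_iff_one _).mpr this ▸ Submodule.mem_top
    | succ q =>
      have : f = 0 := MvPolynomial.funext fun x => by
        rw [map_zero]
        exact hf x ⟨1, one_ne_zero, by simp⟩
      exact this ▸ Ideal.zero_mem _
  | insert ρ s hρ ih =>
    rw [Finset.coe_insert] at hf ⊢
    cases q with
    | zero =>
      have : (1 : MvPolynomial (ι × κ) ℂ) ∈ maxMinorIdeal (insert ρ (s : Set ι)) c :=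
        Ideal.subset_span ⟨Fin.elim0, fun k => k.elim0, by simp⟩
      exact (Ideal.eq_top_iff_one _).mpr this ▸ Submodule.mem_top
    | succ q =>
      exact mem_maxMinorIdeal_insert (by simpa using hρ) hc (fun f => ih hc)
        (fun f => ih (hc.comp (Fin.castSucc_injective q))) hf

section Hessenberg

variable {n : ℕ} [NeZero n] {h : Fin n → Fin n}

/-- The condition cutting out the factor `K_{h(a)}`: the first `h(a)` columns of the matrix with
its first row removed are dependent. -/
def LowerColsDependent (h : Fin n → Fin n) (a : Fin n) (x : Fin n × Fin n → ℂ) : Prop :=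
  ColsDependent ((Finset.univ.erase (0 : Fin n) : Finset (Fin n)) : Set (Fin n))
    (Fin.castLE (h a).isLt : Fin ((h a : ℕ) + 1) → Fin n) x

theorem hessMat_sMat_inl (a r : Fin n) (j : Fin ((a : ℕ) + 1)) :
    hessMat n (sMat n) h a r (Sum.inl j) =
      if r = 0 then X ((0 : Fin n), Fin.castLE a.isLt j) else 0 := by
  simp only [hessMat, sMat, Matrix.of_apply, Sum.elim_inl, Matrix.diagonal_apply]
  rw [Finset.sum_eq_single r]
  · by_cases h0 : r = 0
    · subst h0; simp
    · simp [h0]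
  · intro k _ hk
    simp [hk.symm]
  · simp

theorem LowerColsDependent.mono (hh : Monotone h) {a b : Fin n} (hab : a ≤ b)
    {x : Fin n × Fin n → ℂ} (hx : LowerColsDependent h a x) : LowerColsDependent h b x := by
  obtain ⟨w, hw, hx⟩ := hx
  have hle : (h a : ℕ) + 1 ≤ (h b : ℕ) + 1 := by
    have : h a ≤ h b := hh hab
    simpa using this
  have hinj : Function.Injective (Fin.castLE hle) := Fin.castLE_injective hle
  refine ⟨Function.extend (Fin.castLE hle) w 0, ?_, fun i hi => ?_⟩
  · intro h0
    apply hw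
    funext l
    simpa [hinj.extend_apply] using congrFun h0 (Fin.castLE hle l)
  · rw [← hx i hi]
    symm
    refine Fintype.sum_of_injective _ hinj _ _ (fun l hl => ?_) (fun l => ?_)
    · rw [Function.extend_apply' _ _ _ (by simpa only [Set.mem_range] using hl)]; simp
    · rw [hinj.extend_apply]; rfl

theorem LowerColsDependent.update_zero {b : Fin n} {x : Fin n × Fin n → ℂ}
    (hx : LowerColsDependent h b x) (a : Fin n) (z : ℂ) :
    LowerColsDependent h b (Function.update x (0, a) z) := by
  obtain ⟨w, hw, hx⟩ := hx
  refine ⟨w, hw, fun i hi => ?_⟩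
  have hi0 : i ≠ 0 := by simpa using hi
  have : ∀ k, (i, k) ≠ ((0 : Fin n), a) := by simp [hi0]
  simp only [Function.update_of_ne (this _)]
  exact hx i hi

theorem X_mul_mem_hessIdeal (a : Fin n) {g : R n}
    (hg : g ∈ maxMinorIdeal ((Finset.univ.erase (0 : Fin n) : Finset (Fin n)) : Set (Fin n))
      (Fin.castLE (h a).isLt : Fin ((h a : ℕ) + 1) → Fin n)) :
    X ((0 : Fin n), a) * g ∈ hessIdeal n (sMat n) h := by
  have hle : hessIdealAt n (sMat n) h a ≤ hessIdeal n (sMat n) h := by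
    rw [hessIdeal, Ideal.sum_eq_sup]
    exact Finset.le_sup (f := hessIdealAt n (sMat n) h) (Finset.mem_univ a)
  induction hg using Submodule.span_induction with
  | mem p hp =>
    obtain ⟨B, hB, rfl⟩ := hp
    have hB0 : ∀ k, B k ≠ 0 := fun k => by simpa using hB k
    refine hle (Ideal.subset_span ⟨Fin.cons 0 B,
      Fin.cons (Sum.inl (Fin.last _)) Sum.inr, ?_⟩)
    symm
    rw [Matrix.det_succ_column_zero, Fin.sum_univ_succ, Finset.sum_eq_zero, add_zero]
    · rw [Matrix.submatrix_apply, Fin.cons_zero, Fin.cons_zero, hessMat_sMat_inl, if_pos rfl,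
        Fin.val_zero, pow_zero, one_mul]
      rfl
    · intro k _
      rw [Matrix.submatrix_apply, Fin.cons_zero, Fin.cons_succ, hessMat_sMat_inl,
        if_neg (hB0 k), mul_zero, zero_mul]
  | zero => simp
  | add p p' _ _ hp hp' => rw [mul_add]; exact Ideal.add_mem _ hp hp'
  | smul b p _ hp => rw [smul_eq_mul, mul_left_comm]; exact Ideal.mul_mem_left _ _ hp

/-- A square matrix whose columns lie in the span of too few vectors has determinant zero. -/
theorem det_eq_zero_of_col_mem_span {ι : Type*} [Fintype ι] {m : ℕ}
    (hm : Fintype.card ι < m) (M : Matrix (Fin m) (Fin m) ℂ) (v : ι → Fin m → ℂ)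
    (hM : ∀ j, M.col j ∈ Submodule.span ℂ (Set.range v)) : M.det = 0 := by
  classical
  by_contra hdet
  have hli : LinearIndependent ℂ M.col :=
    Matrix.linearIndependent_cols_iff_isUnit.mpr
      ((Matrix.isUnit_iff_isUnit_det _).mpr (isUnit_iff_ne_zero.mpr hdet))
  have h1 := linearIndependent_le_span' M.col hli (Set.range v) (by
    rintro _ ⟨j, rfl⟩
    exact hM j)
  rw [Cardinal.mk_fin, Nat.cast_le] at h1
  have h2 := Fintype.card_range_le v
  omega

theorem eval_eq_zero_of_mem_hessIdeal (hh : Monotone h) {x : Fin n × Fin n → ℂ}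
    (hx : ∀ a, x (0, a) = 0 ∨ LowerColsDependent h a x) {f : R n}
    (hf : f ∈ hessIdeal n (sMat n) h) : eval x f = 0 := by
  suffices hessIdeal n (sMat n) h ≤ RingHom.ker (eval x) from this hf
  rw [hessIdeal, Ideal.sum_eq_sup]
  refine Finset.sup_le fun a _ => Ideal.span_le.mpr ?_
  rintro _ ⟨r, g, rfl⟩
  rw [SetLike.mem_coe, RingHom.mem_ker, RingHom.map_det]
  by_cases hdep : LowerColsDependent h a x
  · obtain ⟨w, hw, hwx⟩ := hdep
    obtain ⟨l₀, hl₀⟩ := Function.ne_iff.mp hw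
    set v : Fin ((h a : ℕ) + 1) → Fin ((h a : ℕ) + 2) → ℂ := fun l k =>
      if l = l₀ then (if r k = 0 then 1 else 0) else x (r k, Fin.castLE (h a).isLt l) with hv
    have hv₀ : v l₀ = fun k => if r k = 0 then 1 else 0 := by simp [hv]
    have hmem : ∀ l, v l ∈ Submodule.span ℂ (Set.range v) :=
      fun l => Submodule.subset_span ⟨l, rfl⟩
    have hother : ∀ l, l ≠ l₀ → (fun k => x (r k, Fin.castLE (h a).isLt l)) = v l :=
      fun l hl => by simp [hv, hl]
    refine det_eq_zero_of_col_mem_span (by simp) _ v fun j => ?_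
    rcases hj : g j with c | c
    · convert Submodule.smul_mem _ (x (0, Fin.castLE a.isLt c)) (hmem l₀) using 1
      ext k
      simp only [Matrix.col_apply, RingHom.mapMatrix_apply, Matrix.map_apply,
        Matrix.submatrix_apply, hj, hessMat_sMat_inl, hv₀, Pi.smul_apply, smul_eq_mul]
      split_ifs <;> simp
    · have hcol : (((eval x).mapMatrix ((hessMat n (sMat n) h a).submatrix r g)).col j) =
          fun k => x (r k, Fin.castLE (h a).isLt c) := by
        ext k
        simp [hj, hessMat]
      rw [hcol]
      by_cases hc : c = l₀
      · subst hc
        set b : ℂ := ∑ l, w l * x (0, Fin.castLE (h a).isLt l) with hb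
        have hcomb : (fun k => x (r k, Fin.castLE (h a).isLt c)) = (w c)⁻¹ • (b • v c -
            ∑ l ∈ Finset.univ.erase c, w l • v l) := by
          ext k
          have hsum : ∑ l, w l * x (r k, Fin.castLE (h a).isLt l) = b * v c k := by
            rw [hv₀]
            by_cases hk : r k = 0
            · simp [hk, hb]
            · simpa [hk] using hwx (r k) (by simpa using hk)
          rw [← Finset.add_sum_erase _ _ (Finset.mem_univ c)] at hsum
          have hrest : ∑ l ∈ Finset.univ.erase c, w l * x (r k, Fin.castLE (h a).isLt l) =
              ∑ l ∈ Finset.univ.erase c, w l * v l k :=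
            Finset.sum_congr rfl fun l hl => by
              rw [← hother l (Finset.ne_of_mem_erase hl)]
          have hw0 : w c ≠ 0 := hl₀
          simp only [Pi.smul_apply, Pi.sub_apply, Finset.sum_apply, smul_eq_mul]
          rw [← hsum, ← hrest]
          field_simp
          ring
        rw [hcomb]
        exact Submodule.smul_mem _ _ (Submodule.sub_mem _ (Submodule.smul_mem _ _ (hmem c))
          (Submodule.sum_mem _ fun l _ => Submodule.smul_mem _ _ (hmem l)))
      · rw [hother c hc]
        exact hmem c
  · have hzero : ∀ b ≤ a, x (0, b) = 0 := fun b hb =>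
      (hx b).resolve_right fun hd => hdep (hd.mono hh hb)
    refine det_eq_zero_of_col_mem_span (ι := Fin ((h a : ℕ) + 1)) (by simp) _
      (fun l k => x (r k, Fin.castLE (h a).isLt l)) fun j => ?_
    rcases hj : g j with c | c
    · convert Submodule.zero_mem _ using 1
      ext k
      have hc : x (0, Fin.castLE a.isLt c) = 0 :=
        hzero _ (Fin.le_def.mpr (Nat.lt_succ_iff.mp c.isLt))
      simp only [Matrix.col_apply, RingHom.mapMatrix_apply, Matrix.map_apply,
        Matrix.submatrix_apply, hj, hessMat_sMat_inl]
      split_ifs <;> simp [hc]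
    · refine Submodule.subset_span ⟨c, ?_⟩
      ext k
      simp [hj, hessMat]

theorem mem_hessIdeal_of_vanishes (hh : Monotone h) (m : ℕ) (hm : m ≤ n) {f : R n}
    (hf : ∀ x : Fin n × Fin n → ℂ,
      (∀ a : Fin n, m ≤ a → x (0, a) = 0 ∨ LowerColsDependent h a x) → eval x f = 0) :
    f ∈ hessIdeal n (sMat n) h := by
  induction hm using Nat.decreasingInduction generalizing f with
  | self =>
    have : f = 0 := MvPolynomial.funext fun x => by
      rw [map_zero]
      exact hf x fun a ha => absurd a.isLt (by omega)
    exact this ▸ Ideal.zero_mem _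
  | of_succ m hm ih =>
    set a : Fin n := ⟨m, hm⟩ with ha
    obtain ⟨g, hg⟩ := exists_eq_setZero_add ((0 : Fin n), a) f
    have h0 : setZero ((0 : Fin n), a) f ∈ hessIdeal n (sMat n) h := by
      refine ih fun x hx => ?_
      rw [eval_setZero]
      refine hf _ fun b hb => ?_
      rcases hb.eq_or_lt with hb | hb
      · left
        have : b = a := Fin.ext hb.symm
        rw [this, Function.update_self]
      · have hba : b ≠ a := fun h => by rw [h] at hb; simp [ha] at hb
        refine (hx b hb).imp (fun h => ?_) ?_
        · rwa [Function.update_of_ne (by simp [hba])]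
        · exact fun h => h.update_zero a 0
    rw [hg]
    refine Ideal.add_mem _ h0 (X_mul_mem_hessIdeal a
      (mem_maxMinorIdeal_of_vanishesOnDependent _ (Fin.castLE_injective _) ?_))
    intro x hx
    have hzero : (fun z : ℂ => eval (Function.update x (0, a) z) g) = fun _ => 0 := by
      refine Continuous.ext_on (dense_compl_singleton (0 : ℂ))
        ((MvPolynomial.continuous_eval g).comp (by fun_prop)) continuous_const fun z hz => ?_
      have hv : ∀ y : ℂ, eval (Function.update x (0, a) y) f = 0 := fun y =>
        hf _ fun b hb => Or.inr
          ((LowerColsDependent.mono hh (Fin.mk_le_of_le_val hb) hx).update_zero a y)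
      have h1 := hv z
      rw [hg, map_add, map_mul, eval_setZero, Function.update_idem, hv, zero_add, eval_X,
        Function.update_self] at h1
      exact (mul_eq_zero.mp h1).resolve_left hz
    simpa using congrFun hzero (x (0, a))

end Hessenberg

/-- the ideal `I_{s,h}` is radical, for `s = diag(1,0,…,0)`. -/
theorem stmt1 (n : ℕ) [NeZero n] (h : Fin n → Fin n) (hh : IsHessenberg n h) :
    (hessIdeal n (sMat n) h).radical = hessIdeal n (sMat n) h := by
  refine le_antisymm (fun f hf => ?_) Ideal.le_radical
  obtain ⟨k, hk⟩ := hf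
  refine mem_hessIdeal_of_vanishes hh.1 0 (Nat.zero_le n) fun x hx => ?_
  have := eval_eq_zero_of_mem_hessIdeal hh.1 (fun a => hx a (Nat.zero_le _)) hk
  rw [map_pow] at this
  exact eq_zero_of_pow_eq_zero this
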